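/- arXiv:2411.15081 — 14 statements merged into one kernel-verified Lean document; each statement's English description precedes it below -/
import Mathlib

section
/- Let X be a nonempty set and E an equivalence relation on X. The semigroup Q_{E^*}(X) is a group (i.e., it has a two-sided identity element and every element has an inverse with respect to it) if and only if E is the identity relation I_X = {(x,x) : x ∈ X} on X. -/
/-- Composition written left-to-right: `(x)(a·b) = ((x)a)b`. -/
def rcomp {X : Type*} (a b : X → X) : X → X := fun x => b (a x)

/-- The semigroup `Q_{E^*}(X)`: maps preserving `E` in both directions such that the image of
each `E`-class is a singleton and each `E`-class meets the range. -/
def QEstar {X : Type*} (E : Setoid X) : Set (X → X) :=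
  {α | (∀ x y : X, E.r x y ↔ E.r (α x) (α y)) ∧
       (∀ x y : X, E.r x y → α x = α y) ∧
       (∀ x : X, ∃ z : X, E.r x (α z))}

/-- Sending each point to a chosen representative of its class gives an element of `QEstar E`. -/
theorem section_comp_mk_mem_QEstar {X : Type*} (E : Setoid X) (s : Quotient E → X)
    (hs : ∀ q, Quotient.mk E (s q) = q) : (fun z => s (Quotient.mk E z)) ∈ QEstar E := by
  have hrel (z : X) : E.r (s (Quotient.mk E z)) z := Quotient.exact (hs _)
  refine ⟨fun x y => ⟨fun h => ?_, fun h => ?_⟩, fun x y h => congrArg s (Quotient.sound h),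
    fun x => ⟨x, E.symm (hrel x)⟩⟩
  · exact E.trans (hrel x) (E.trans h (E.symm (hrel y)))
  · exact E.trans (E.symm (hrel x)) (E.trans h (hrel y))

theorem exists_mem_QEstar_apply_eq_self {X : Type*} (E : Setoid X) (x : X) :
    ∃ a ∈ QEstar E, a x = x := by
  classical
  refine ⟨_, section_comp_mk_mem_QEstar E
    (Function.update Quotient.out (Quotient.mk E x) x) fun q => ?_, by simp⟩
  by_cases hq : q = Quotient.mk E x
  · subst hq
    simp
  · simp [Function.update_of_ne hq]

theorem mem_QEstar_iff_bijective {X : Type*} {E : Setoid X} (hE : ∀ x y : X, E.r x y ↔ x = y)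
    {a : X → X} : a ∈ QEstar E ↔ Function.Bijective a := by
  simp only [QEstar, Set.mem_ofPred_eq, hE]
  refine ⟨fun ⟨h₁, _, h₃⟩ => ⟨fun x y h => (h₁ x y).2 h, fun x => ?_⟩, fun h =>
    ⟨fun x y => h.1.eq_iff.symm, fun x y h => congrArg a h, fun x => ?_⟩⟩
  · obtain ⟨z, hz⟩ := h₃ x
    exact ⟨z, hz.symm⟩
  · obtain ⟨z, hz⟩ := h.2 x
    exact ⟨z, hz.symm⟩

/-- `Q_{E^*}(X)` is a group (has a two-sided identity and two-sided inverses)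
if and only if `E` is the identity relation on `X`. -/
theorem stmt2 {X : Type*} [Nonempty X] (E : Setoid X) :
    (∃ e ∈ QEstar E, (∀ a ∈ QEstar E, rcomp e a = a ∧ rcomp a e = a) ∧
        ∀ a ∈ QEstar E, ∃ b ∈ QEstar E, rcomp a b = e ∧ rcomp b a = e)
      ↔ (∀ x y : X, E.r x y ↔ x = y) := by
  constructor
  · rintro ⟨e, he, hid, -⟩ x y
    have hfix (z : X) : e z = z := by
      obtain ⟨a, ha, haz⟩ := exists_mem_QEstar_apply_eq_self E z
      have h := congrFun (hid a ha).2 z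
      rwa [rcomp, haz] at h
    refine ⟨fun h => ?_, fun h => h ▸ E.refl x⟩
    rw [← hfix x, he.2.1 x y h, hfix y]
  · intro hE
    refine ⟨id, (mem_QEstar_iff_bijective hE).2 Function.bijective_id,
      fun a _ => ⟨rfl, rfl⟩, fun a ha => ?_⟩
    let f := Equiv.ofBijective a ((mem_QEstar_iff_bijective hE).1 ha)
    exact ⟨f.symm, (mem_QEstar_iff_bijective hE).2 f.symm.bijective,
      funext f.symm_apply_apply, funext f.apply_symm_apply⟩
end

section
/- Let G₁ and G₂ be groups and let E₁ and E₂ be nonempty right zero semigroups. Then the product semigroups G₁ × E₁ and G₂ × E₂ (with componentwise multiplication) are isomorphic as semigroups if and only if G₁ is isomorphic to G₂ as groups and there is a bijection between E₁ and E₂. -/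
section RightZero

variable {G H E F : Type*} [Group G] [Group H] [Semigroup E] [Semigroup F]

theorem fst_map_one_mk (f : G × E →ₙ* H × F) (hE : ∀ a b : E, a * b = b) (e : E) :
    (f (1, e)).1 = 1 := by
  have h : f (1, e) * f (1, e) = f (1, e) := by
    rw [← map_mul, Prod.mk_mul_mk, mul_one, hE]
  exact mul_eq_left.mp (congrArg Prod.fst h)

theorem fst_map_mk_eq (f : G × E →ₙ* H × F) (hE : ∀ a b : E, a * b = b) (g : G) (e e' : E) :
    (f (g, e)).1 = (f (g, e')).1 := by
  have h : f (g, e) = f (g, e') * f (1, e) := by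
    rw [← map_mul, Prod.mk_mul_mk, mul_one, hE]
  rw [h, Prod.fst_mul, fst_map_one_mk f hE, mul_one]

theorem snd_map_mk_eq (f : G × E →ₙ* H × F) (hE : ∀ a b : E, a * b = b)
    (hF : ∀ a b : F, a * b = b) (g g' : G) (e : E) :
    (f (g, e)).2 = (f (g', e)).2 := by
  have h : f (g, e) = f (g * g'⁻¹, e) * f (g', e) := by
    rw [← map_mul, Prod.mk_mul_mk, inv_mul_cancel_right, hE]
  rw [h, Prod.snd_mul, hF]

theorem fst_symm_apply_fst (f : G × E ≃* H × F) (hF : ∀ a b : F, a * b = b)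
    (g : G) (e : E) (e' : F) :
    (f.symm ((f (g, e)).1, e')).1 = g :=
  (fst_map_mk_eq (f.symm : H × F →ₙ* G × E) hF _ e' (f (g, e)).2).trans
    (congrArg Prod.fst (f.symm_apply_apply (g, e)))

theorem snd_symm_apply_snd (f : G × E ≃* H × F) (hE : ∀ a b : E, a * b = b)
    (hF : ∀ a b : F, a * b = b) (g : G) (e : E) (h : H) :
    (f.symm (h, (f (g, e)).2)).2 = e :=
  (snd_map_mk_eq (f.symm : H × F →ₙ* G × E) hF hE h (f (g, e)).1 _).trans
    (congrArg Prod.snd (f.symm_apply_apply (g, e)))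

/-- The isomorphism of group factors induced by an isomorphism of right groups. -/
def groupEquivOfProd (f : G × E ≃* H × F) (hE : ∀ a b : E, a * b = b)
    (hF : ∀ a b : F, a * b = b) (e : E) (e' : F) : G ≃* H where
  toFun g := (f (g, e)).1
  invFun h := (f.symm (h, e')).1
  left_inv g := fst_symm_apply_fst f hF g e e'
  right_inv h := fst_symm_apply_fst f.symm hE h e' e
  map_mul' g g' := by
    rw [← Prod.fst_mul, ← map_mul, Prod.mk_mul_mk, hE]

/-- The bijection of right zero factors induced by an isomorphism of right groups. -/
def rightZeroEquivOfProd (f : G × E ≃* H × F) (hE : ∀ a b : E, a * b = b)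
    (hF : ∀ a b : F, a * b = b) : E ≃ F where
  toFun e := (f (1, e)).2
  invFun e' := (f.symm (1, e')).2
  left_inv e := snd_symm_apply_snd f hE hF 1 e 1
  right_inv e' := snd_symm_apply_snd f.symm hF hE 1 e' 1

end RightZero

/-- for groups `G₁, G₂` and nonempty right zero semigroups `E₁, E₂`, the product
semigroups `G₁ × E₁` and `G₂ × E₂` are isomorphic if and only if `G₁ ≅ G₂` as groups and there
is a bijection between `E₁` and `E₂`. -/
theorem stmt3 {G₁ G₂ E₁ E₂ : Type*} [Group G₁] [Group G₂]
    [Semigroup E₁] [Semigroup E₂] [Nonempty E₁] [Nonempty E₂]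
    (h₁ : ∀ a b : E₁, a * b = b) (h₂ : ∀ a b : E₂, a * b = b) :
    Nonempty ((G₁ × E₁) ≃* (G₂ × E₂)) ↔ (Nonempty (G₁ ≃* G₂) ∧ Nonempty (E₁ ≃ E₂)) := by
  constructor
  · rintro ⟨f⟩
    obtain ⟨e₁⟩ := ‹Nonempty E₁›
    obtain ⟨e₂⟩ := ‹Nonempty E₂›
    exact ⟨⟨groupEquivOfProd f h₁ h₂ e₁ e₂⟩, ⟨rightZeroEquivOfProd f h₁ h₂⟩⟩
  · rintro ⟨⟨φ⟩, ⟨ψ⟩⟩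
    refine ⟨{ φ.toEquiv.prodCongr ψ with map_mul' := fun a b => Prod.ext (map_mul φ a.1 b.1) ?_ }⟩
    exact (congrArg ψ (h₁ a.2 b.2)).trans (h₂ (ψ a.2) (ψ b.2)).symm
end

section
/- Let X be a nonempty set and E an equivalence relation on X. There is a bijection between the set of idempotent elements of Q_{E^*}(X) and the product ∏_{A ∈ X/E} A of the E-classes (i.e., the set of functions choosing one element from each E-class); in particular the cardinality of the set of idempotents of Q_{E^*}(X) equals the cardinal product ∏_{A ∈ X/E} |A|. -/
/-- An idempotent of `Q_{E^*}(X)` maps every point into its own `E`-class. -/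
theorem mk_apply_of_idempotent_mem_QEstar {X : Type*} {E : Setoid X} {α : X → X}
    (hα : α ∈ QEstar E) (hi : rcomp α α = α) (x : X) :
    Quotient.mk E (α x) = Quotient.mk E x := by
  obtain ⟨z, hz⟩ := hα.2.2 x
  have h : α x = α z := (hα.2.1 _ _ hz).trans (congrFun hi z)
  rw [h]
  exact (Quotient.sound hz).symm

/-- Idempotents of `Q_{E^*}(X)` correspond to choices of one element from each `E`-class. -/
noncomputable def idempotentsQEstarEquiv {X : Type*} (E : Setoid X) :
    {α : X → X // α ∈ QEstar E ∧ rcomp α α = α} ≃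
      ∀ q : Quotient E, {x : X // Quotient.mk E x = q} where
  toFun α q := ⟨α.1 q.out,
    (mk_apply_of_idempotent_mem_QEstar α.2.1 α.2.2 _).trans q.out_eq⟩
  invFun f := ⟨fun x => (f (Quotient.mk E x)).1, by
    have hf (x : X) : Quotient.mk E (f (Quotient.mk E x)).1 = Quotient.mk E x :=
      (f (Quotient.mk E x)).2
    have hc (x y : X) (h : Quotient.mk E x = Quotient.mk E y) :
        (f (Quotient.mk E x)).1 = (f (Quotient.mk E y)).1 := by rw [h]
    refine ⟨⟨fun x y => ⟨fun h => ?_, fun h => ?_⟩, fun x y h => hc x y (Quotient.sound h),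
      fun x => ⟨x, Quotient.exact (hf x).symm⟩⟩, funext fun x => hc _ _ (hf x)⟩
    · exact Quotient.exact (((hf x).trans (Quotient.sound h)).trans (hf y).symm)
    · exact Quotient.exact (((hf x).symm.trans (Quotient.sound h)).trans (hf y))⟩
  left_inv α := Subtype.ext <| funext fun x =>
    α.2.1.2.1 _ _ (Quotient.exact (Quotient.mk E x).out_eq)
  right_inv f := funext fun q => Subtype.ext <| by
    change (f (Quotient.mk E q.out)).1 = (f q).1
    rw [q.out_eq]

/-- the idempotents of `Q_{E^*}(X)` are in bijection with the product of the
`E`-classes; in particular the cardinality of the set of idempotents equals the cardinal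
product of the sizes of the `E`-classes. -/
theorem stmt4 {X : Type*} [Nonempty X] (E : Setoid X) :
    Nonempty ({α : X → X // α ∈ QEstar E ∧ rcomp α α = α} ≃
        ∀ q : Quotient E, {x : X // Quotient.mk E x = q}) ∧
    Cardinal.mk {α : X → X // α ∈ QEstar E ∧ rcomp α α = α} =
      Cardinal.prod (fun q : Quotient E => Cardinal.mk {x : X // Quotient.mk E x = q}) := by
  exact ⟨⟨idempotentsQEstarEquiv E⟩, by
    rw [← Cardinal.mk_pi]
    exact Cardinal.mk_congr (idempotentsQEstarEquiv E)⟩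
end

section
/- Let X be a nonempty set and E an equivalence relation on X. The set E(Q_{E^*}(X)) of idempotents of Q_{E^*}(X) is closed under composition and satisfies e∘f = f (composition applied left-to-right) for all idempotents e, f; and Q_{E^*}(X) is isomorphic as a semigroup to the direct product S_{X/E} × E(Q_{E^*}(X)) of the symmetric group on the quotient set X/E and this right zero semigroup of idempotents. -/
namespace QEstar

variable {X : Type*} {E : Setoid X}

/-- The map `X/E → X` induced by an element of `Q_{E^*}(X)`. -/
def desc {a : X → X} (ha : a ∈ QEstar E) : Quotient E → X :=
  Quotient.lift a fun x y h => ha.2.1 x y h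

@[simp]
theorem desc_mk {a : X → X} (ha : a ∈ QEstar E) (x : X) : desc ha (Quotient.mk E x) = a x := rfl

theorem mk_desc_bijective {a : X → X} (ha : a ∈ QEstar E) :
    Function.Bijective fun q => Quotient.mk E (desc ha q) := by
  constructor
  · intro p q
    induction p, q using Quotient.inductionOn₂ with
    | _ x y => exact fun h => Quotient.sound ((ha.1 x y).2 (Quotient.exact h))
  · intro q
    induction q using Quotient.inductionOn with
    | _ x =>
      obtain ⟨z, hz⟩ := ha.2.2 x
      exact ⟨Quotient.mk E z, Quotient.sound (E.symm hz)⟩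

/-- The permutation of `X/E` induced by an element of `Q_{E^*}(X)`. -/
noncomputable def perm {a : X → X} (ha : a ∈ QEstar E) : Equiv.Perm (Quotient E) :=
  Equiv.ofBijective _ (mk_desc_bijective ha)

@[simp]
theorem perm_mk {a : X → X} (ha : a ∈ QEstar E) (x : X) :
    perm ha (Quotient.mk E x) = Quotient.mk E (a x) := rfl

theorem mem_of_mk_eq {s : Quotient E → X} (σ : Equiv.Perm (Quotient E))
    (hs : ∀ q, Quotient.mk E (s q) = σ q) : (fun x => s (Quotient.mk E x)) ∈ QEstar E := by
  refine ⟨fun x y => ?_, fun x y h => congrArg s (Quotient.sound h), fun x => ?_⟩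
  · rw [← Quotient.eq, ← Quotient.eq, hs, hs, σ.injective.eq_iff]
  · obtain ⟨z, hz⟩ := Quotient.exists_rep (σ.symm (Quotient.mk E x))
    refine ⟨z, Quotient.exact ?_⟩
    change Quotient.mk E x = Quotient.mk E (s (Quotient.mk E z))
    rw [hs, show Quotient.mk E z = _ from hz, σ.apply_symm_apply]

theorem mk_apply_of_idempotent {e : X → X} (he : e ∈ QEstar E) (h : rcomp e e = e) (x : X) :
    Quotient.mk E (e x) = Quotient.mk E x := by
  refine Quotient.sound ((he.1 _ _).2 ?_)
  rw [show e (e x) = e x from congrFun h x]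

theorem rcomp_eq_right {e f : X → X} (he : e ∈ QEstar E) (h : rcomp e e = e)
    (hf : f ∈ QEstar E) : rcomp e f = f :=
  funext fun x => hf.2.1 _ _ (Quotient.exact (mk_apply_of_idempotent he h x))

theorem mk_desc_of_idempotent {e : X → X} (he : e ∈ QEstar E) (h : rcomp e e = e)
    (q : Quotient E) : Quotient.mk E (desc he q) = q :=
  Quotient.inductionOn q (mk_apply_of_idempotent he h)

/-- The idempotent with the same range as a given element of `Q_{E^*}(X)`. -/
noncomputable def idem {a : X → X} (ha : a ∈ QEstar E) : X → X :=
  fun x => desc ha ((perm ha).symm (Quotient.mk E x))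

theorem mk_desc_perm_symm {a : X → X} (ha : a ∈ QEstar E) (q : Quotient E) :
    Quotient.mk E (desc ha ((perm ha).symm q)) = q :=
  (perm ha).apply_symm_apply q

theorem idem_mem {a : X → X} (ha : a ∈ QEstar E) : idem ha ∈ QEstar E :=
  mem_of_mk_eq (s := fun q => desc ha ((perm ha).symm q)) 1 (mk_desc_perm_symm ha)

theorem rcomp_idem_self {a : X → X} (ha : a ∈ QEstar E) :
    rcomp (idem ha) (idem ha) = idem ha :=
  funext fun x =>
    congrArg (fun q => desc ha ((perm ha).symm q)) (mk_desc_perm_symm ha (Quotient.mk E x))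

theorem idem_apply_apply {a : X → X} (ha : a ∈ QEstar E) (x : X) : idem ha (a x) = a x := by
  rw [idem, ← perm_mk ha, Equiv.symm_apply_apply, desc_mk]

theorem perm_rcomp {a b : X → X} (ha : a ∈ QEstar E) (hb : b ∈ QEstar E)
    (hab : rcomp a b ∈ QEstar E) : perm hab = perm hb * perm ha :=
  Equiv.ext fun q => Quotient.inductionOn q fun _ => rfl

theorem idem_rcomp {a b : X → X} (hb : b ∈ QEstar E) (hab : rcomp a b ∈ QEstar E) :
    idem hab = idem hb := by
  funext x
  obtain ⟨z, hz⟩ := hab.2.2 x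
  rw [(idem_mem hab).2.1 _ _ hz, (idem_mem hb).2.1 _ _ hz, idem_apply_apply hab]
  exact (idem_apply_apply hb (a z)).symm

/-- The element of `Q_{E^*}(X)` that acts as `σ⁻¹` on `X/E` and has the same range as the
idempotent `e`. -/
def ofPermIdem (σ : Equiv.Perm (Quotient E)) {e : X → X} (he : e ∈ QEstar E) : X → X :=
  fun x => desc he (σ.symm (Quotient.mk E x))

theorem ofPermIdem_mem (σ : Equiv.Perm (Quotient E)) {e : X → X} (he : e ∈ QEstar E)
    (h : rcomp e e = e) : ofPermIdem σ he ∈ QEstar E :=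
  mem_of_mk_eq (s := fun q => desc he (σ.symm q)) σ.symm fun _ => mk_desc_of_idempotent he h _

/-- The decomposition of `Q_{E^*}(X)`. The permutation is inverted because maps compose
left-to-right in `Q_{E^*}(X)` and right-to-left in `Equiv.Perm`. -/
noncomputable def equivPermProd (E : Setoid X) : {α : X → X // α ∈ QEstar E} ≃
    (Equiv.Perm (Quotient E) × {α : X → X // α ∈ QEstar E ∧ rcomp α α = α}) where
  toFun a := ((perm a.2)⁻¹, ⟨idem a.2, idem_mem a.2, rcomp_idem_self a.2⟩)
  invFun p := ⟨ofPermIdem p.1 p.2.2.1, ofPermIdem_mem p.1 p.2.2.1 p.2.2.2⟩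
  left_inv a := Subtype.ext <| funext fun x => idem_apply_apply a.2 x
  right_inv := by
    rintro ⟨σ, e, he, h⟩
    have hσ : perm (ofPermIdem_mem σ he h) = σ⁻¹ :=
      Equiv.ext fun q => Quotient.inductionOn q fun _ => mk_desc_of_idempotent he h _
    refine Prod.ext (by simp [hσ]) (Subtype.ext (funext fun x => ?_))
    obtain ⟨y, hy⟩ := Quotient.exists_rep (σ (Quotient.mk E x))
    change desc (ofPermIdem_mem σ he h)
      ((perm (ofPermIdem_mem σ he h))⁻¹ (Quotient.mk E x)) = e x
    rw [hσ, inv_inv, ← hy]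
    change desc he (σ.symm (Quotient.mk E y)) = e x
    rw [show Quotient.mk E y = _ from hy, σ.symm_apply_apply, desc_mk]

end QEstar

/-- the idempotents of `Q_{E^*}(X)` form a right zero semigroup under composition
(`e ∘ f = f`, composition left-to-right), and `Q_{E^*}(X)` is isomorphic as a semigroup to the
direct product of the symmetric group on `X/E` with this right zero semigroup of idempotents. -/
theorem stmt5 {X : Type*} [Nonempty X] (E : Setoid X) :
    (∀ e ∈ QEstar E, rcomp e e = e → ∀ f ∈ QEstar E, rcomp f f = f →
        rcomp e f ∈ QEstar E ∧ rcomp (rcomp e f) (rcomp e f) = rcomp e f ∧ rcomp e f = f) ∧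
    ∃ φ : {α : X → X // α ∈ QEstar E} ≃
        (Equiv.Perm (Quotient E) × {α : X → X // α ∈ QEstar E ∧ rcomp α α = α}),
      ∀ (a b : {α : X → X // α ∈ QEstar E}) (hab : rcomp a.1 b.1 ∈ QEstar E),
        φ ⟨rcomp a.1 b.1, hab⟩ = ((φ a).1 * (φ b).1, (φ b).2) := by
  refine ⟨fun e he h f hf hff => ?_, QEstar.equivPermProd E, fun a b hab => ?_⟩
  · rw [QEstar.rcomp_eq_right he h hf]
    exact ⟨hf, hff, rfl⟩
  · refine Prod.ext ?_ (Subtype.ext (QEstar.idem_rcomp b.2 hab))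
    change (QEstar.perm hab)⁻¹ = (QEstar.perm a.2)⁻¹ * (QEstar.perm b.2)⁻¹
    rw [QEstar.perm_rcomp a.2 b.2 hab, mul_inv_rev]
end

section
/- Let E and F be equivalence relations on nonempty sets X and Y, respectively. Then Q_{E^*}(X) and Q_{F^*}(Y) are isomorphic as semigroups if and only if there is a bijection between the quotient sets X/E and Y/F and a bijection between the products ∏_{A ∈ X/E} A and ∏_{B ∈ Y/F} B (equivalently, |X/E| = |Y/F| and ∏_{A ∈ X/E} |A| = ∏_{B ∈ Y/F} |B| as cardinals). -/
/-- In a symmetric group, every nontrivial conjugacy class is at least as large as the set of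
points different from some given point. -/
theorem Equiv.Perm.exists_embedding_conjugates {A : Type*} {σ : Equiv.Perm A} (hσ : σ ≠ 1) :
    ∃ a : A, Nonempty ({c : A // c ≠ a} ↪ {τ : Equiv.Perm A // IsConj σ τ}) := by
  classical
  obtain ⟨a, ha⟩ : ∃ a, σ a ≠ a := by
    by_contra! h
    exact hσ (Equiv.ext h)
  refine ⟨a, ⟨fun c => ⟨Equiv.swap (σ a) c * σ * (Equiv.swap (σ a) c)⁻¹,
    isConj_iff.2 ⟨_, rfl⟩⟩, ?_⟩⟩
  have key : ∀ c : {c : A // c ≠ a},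
      (Equiv.swap (σ a) c * σ * (Equiv.swap (σ a) c)⁻¹ : Equiv.Perm A) a = c := by
    intro c
    simp [Equiv.swap_apply_of_ne_of_ne ha.symm c.2.symm]
  intro c d h
  have h' := congrArg (fun τ : {τ : Equiv.Perm A // IsConj σ τ} => τ.1 a) h
  simp only [key] at h'
  exact Subtype.ext h'

theorem Equiv.Perm.infinite_of_infinite (A : Type*) [Infinite A] : Infinite (Equiv.Perm A) := by
  classical
  obtain ⟨a⟩ : Nonempty A := inferInstance
  refine Infinite.of_injective (fun c : A => Equiv.swap a c) fun c d h => ?_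
  simpa using congrArg (fun τ : Equiv.Perm A => τ a) h

open Cardinal in
/-- Infinite types with isomorphic symmetric groups: one embeds in the other. -/
theorem Equiv.Perm.nonempty_embedding_of_mulEquiv {A : Type*} {B : Type*} [Infinite A] [Infinite B]
    (φ : Equiv.Perm A ≃* Equiv.Perm B) : Nonempty (B ↪ A) := by
  classical
  obtain ⟨x, y, hxy⟩ := exists_pair_ne A
  have hτ : φ (Equiv.swap x y) ≠ 1 := by
    rw [Ne, MulEquiv.map_eq_one_iff]
    exact fun h => hxy (Equiv.swap_eq_one_iff.1 h)
  obtain ⟨b, ⟨f⟩⟩ := Equiv.Perm.exists_embedding_conjugates hτ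
  have hconj : ∀ τ : {τ : Equiv.Perm B // IsConj (φ (Equiv.swap x y)) τ},
      ∃ p : A × A, φ (Equiv.swap p.1 p.2) = τ := by
    rintro ⟨τ, hτ⟩
    obtain ⟨g, rfl⟩ := isConj_iff.1 hτ
    refine ⟨(φ.symm g x, φ.symm g y), ?_⟩
    simp [Equiv.swap_apply_apply]
  choose p hp using hconj
  have hpinj : Function.Injective p := fun s t h => Subtype.ext (by rw [← hp s, ← hp t, h])
  have eB : Nonempty (B ≃ {c : B // c ≠ b}) := by
    have h : #({b}ᶜ : Set B) = #B := Cardinal.mk_compl_of_infinite {b}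
      (by simpa using (Cardinal.one_lt_aleph0.trans_le (Cardinal.aleph0_le_mk B)))
    exact (Cardinal.eq.1 h.symm)
  have eA : Nonempty (A × A ≃ A) := Cardinal.eq.1 (by simp)
  obtain ⟨eB⟩ := eB
  obtain ⟨eA⟩ := eA
  exact ⟨((eB.toEmbedding.trans f).trans ⟨p, hpinj⟩).trans eA.toEmbedding⟩

/-- Nonempty types with isomorphic symmetric groups are equinumerous. -/
theorem Equiv.Perm.nonempty_equiv_of_mulEquiv {A B : Type*} [Nonempty A] [Nonempty B]
    (φ : Equiv.Perm A ≃* Equiv.Perm B) : Nonempty (A ≃ B) := by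
  classical
  rcases finite_or_infinite A with hA | hA <;> rcases finite_or_infinite B with hB | hB
  · have h := Nat.card_congr φ.toEquiv
    rw [Nat.card_perm, Nat.card_perm] at h
    have hA0 : 0 < Nat.card A := Nat.card_pos
    have hB0 : 0 < Nat.card B := Nat.card_pos
    refine Finite.card_eq.1 ?_
    rcases lt_trichotomy (Nat.card A) (Nat.card B) with hlt | heq | hlt
    · exact absurd h (Nat.factorial_lt_of_lt hA0 hlt).ne
    · exact heq
    · exact absurd h (Nat.factorial_lt_of_lt hB0 hlt).ne'
  · have := Equiv.Perm.infinite_of_infinite B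
    exact (not_finite_iff_infinite.2 this (Finite.of_equiv _ φ.toEquiv)).elim
  · have := Equiv.Perm.infinite_of_infinite A
    exact (not_finite_iff_infinite.2 this (Finite.of_equiv _ φ.symm.toEquiv)).elim
  · obtain ⟨f⟩ := Equiv.Perm.nonempty_embedding_of_mulEquiv φ
    obtain ⟨g⟩ := Equiv.Perm.nonempty_embedding_of_mulEquiv φ.symm
    exact Function.Embedding.antisymm g f

/-- The product of a right group, written as pairs of a group element and an element of a
right zero band, with the group multiplied from left to right. -/
def rightGroupMul {G S : Type*} [Mul G] (p q : G × S) : G × S := (q.1 * p.1, q.2)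

/-- An isomorphism of right groups induces an isomorphism of their groups and a bijection of
their right zero bands. -/
theorem nonempty_mulEquiv_and_equiv_of_rightGroup {G H S T : Type*} [Group G] [Group H]
    [Nonempty S] (ψ : G × S ≃ H × T)
    (hψ : ∀ p q, ψ (rightGroupMul p q) = rightGroupMul (ψ p) (ψ q)) :
    Nonempty (G ≃* H) ∧ Nonempty (S ≃ T) := by
  have idem : ∀ p : G × S, p.1 = 1 ↔ (ψ p).1 = 1 := by
    intro p
    have hG : rightGroupMul p p = p ↔ p.1 = 1 := by
      simp [rightGroupMul, Prod.ext_iff]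
    have hH : rightGroupMul (ψ p) (ψ p) = ψ p ↔ (ψ p).1 = 1 := by
      simp [rightGroupMul, Prod.ext_iff]
    rw [← hG, ← hH, ← hψ, ψ.apply_eq_iff_eq]
  constructor
  · obtain ⟨s⟩ := ‹Nonempty S›
    let f : G →* H := MonoidHom.mk' (fun g => (ψ (g, s)).1)
      fun a b => congrArg Prod.fst (hψ (b, s) (a, s))
    refine ⟨MulEquiv.ofBijective f ⟨?_, ?_⟩⟩
    · rw [injective_iff_map_eq_one]
      exact fun a ha => (idem (a, s)).2 ha
    · intro h
      obtain ⟨⟨g, t⟩, hg⟩ := ψ.surjective (h, (ψ (1, s)).2)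
      have h1 : ψ (rightGroupMul (g, t) (1, s)) = ψ (g, t) := by
        rw [hψ, hg]
        simp [rightGroupMul, (idem (1, s)).1 rfl]
      have hts : s = t := congrArg Prod.snd (ψ.injective h1)
      subst hts
      exact ⟨g, congrArg Prod.fst hg⟩
  · refine ⟨⟨fun s => (ψ (1, s)).2, fun t => (ψ.symm (1, t)).2, fun s => ?_, fun t => ?_⟩⟩
    · have h : ((1 : H), (ψ (1, s)).2) = ψ (1, s) := Prod.ext ((idem (1, s)).1 rfl).symm rfl
      simp [h]
    · have h : ((1 : G), (ψ.symm (1, t)).2) = ψ.symm (1, t) :=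
        Prod.ext ((idem _).2 (by simp)).symm rfl
      simp [h]

/-- The type of transversals of an equivalence relation. -/
abbrev Transversal {X : Type*} (E : Setoid X) : Type _ :=
  ∀ q : Quotient E, {x : X // Quotient.mk E x = q}

namespace QEstar

variable {X : Type*} {E : Setoid X}

/-- The map determined by a permutation of the classes and a transversal. -/
def ofPair (p : Equiv.Perm (Quotient E) × Transversal E) : X → X :=
  fun x => p.2 (p.1 (Quotient.mk E x))

theorem mk_ofPair (p : Equiv.Perm (Quotient E) × Transversal E) (x : X) :
    Quotient.mk E (ofPair p x) = p.1 (Quotient.mk E x) :=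
  (p.2 (p.1 (Quotient.mk E x))).2

theorem ofPair_mem (p : Equiv.Perm (Quotient E) × Transversal E) : ofPair p ∈ QEstar E := by
  have hr : ∀ x y : X, E.r x y ↔ Quotient.mk E x = Quotient.mk E y :=
    fun x y => Quotient.eq.symm
  refine ⟨fun x y => ?_, fun x y h => ?_, fun x => ?_⟩
  · rw [hr, hr, mk_ofPair, mk_ofPair, p.1.apply_eq_iff_eq]
  · exact congrArg (fun c => (p.2 (p.1 c) : X)) ((hr x y).1 h)
  · refine ⟨(p.1.symm (Quotient.mk E x)).out, ?_⟩
    rw [hr, mk_ofPair, Quotient.out_eq, Equiv.apply_symm_apply]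

theorem ofPair_rightGroupMul (p q : Equiv.Perm (Quotient E) × Transversal E) :
    ofPair (rightGroupMul p q) = rcomp (ofPair p) (ofPair q) := by
  funext x
  simp only [rcomp]
  rw [ofPair, ofPair, mk_ofPair]
  rfl

theorem ofPair_injective :
    Function.Injective (ofPair : Equiv.Perm (Quotient E) × Transversal E → X → X) := by
  rintro ⟨σ, s⟩ ⟨τ, t⟩ h
  have hστ : σ = τ := by
    ext q
    induction q using Quotient.inductionOn with
    | h x => rw [← mk_ofPair (σ, s), h, mk_ofPair]
  subst hστ
  congr
  funext q
  obtain ⟨q, rfl⟩ := σ.surjective q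
  induction q using Quotient.inductionOn with
  | h x => exact Subtype.ext (congrFun h x)

theorem exists_ofPair_eq {α : X → X} (hα : α ∈ QEstar E) :
    ∃ p : Equiv.Perm (Quotient E) × Transversal E, ofPair p = α := by
  obtain ⟨h1, h2, h3⟩ := hα
  let f : Quotient E → Quotient E := Quotient.map α fun x y h => (h1 x y).1 h
  have hf : Function.Bijective f := by
    constructor
    · intro p q
      induction p, q using Quotient.inductionOn₂ with
      | h x y => exact fun h => Quotient.sound ((h1 x y).2 (Quotient.exact h))
    · intro q
      induction q using Quotient.inductionOn with
      | h x =>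
        obtain ⟨z, hz⟩ := h3 x
        exact ⟨Quotient.mk E z, Quotient.sound (E.symm hz)⟩
  let σ : Equiv.Perm (Quotient E) := Equiv.ofBijective f hf
  have hσ : ∀ x, σ (Quotient.mk E x) = Quotient.mk E (α x) := fun x => rfl
  refine ⟨(σ, fun q => ⟨α (σ.symm q).out, ?_⟩), ?_⟩
  · rw [← hσ, Quotient.out_eq, Equiv.apply_symm_apply]
  · funext x
    simp only [ofPair, Equiv.symm_apply_apply]
    exact h2 _ _ (Quotient.mk_out x)

/-- `Q_{E^*}(X)` as a right group. -/
noncomputable def equivPair (E : Setoid X) :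
    Equiv.Perm (Quotient E) × Transversal E ≃ {α : X → X // α ∈ QEstar E} :=
  Equiv.ofBijective (fun p => ⟨ofPair p, ofPair_mem p⟩)
    ⟨fun _ _ h => ofPair_injective (congrArg Subtype.val h), fun α =>
      (exists_ofPair_eq α.2).imp fun _ h => Subtype.ext h⟩

theorem coe_equivPair_rightGroupMul (p q : Equiv.Perm (Quotient E) × Transversal E) :
    (equivPair E (rightGroupMul p q) : X → X) = rcomp (equivPair E p) (equivPair E q) :=
  ofPair_rightGroupMul p q

end QEstar

/-- `Q_{E^*}(X)` and `Q_{F^*}(Y)` are isomorphic as semigroups (there is a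
multiplicative bijection) if and only if there are bijections `X/E ≃ Y/F` and
`∏_{A ∈ X/E} A ≃ ∏_{B ∈ Y/F} B`. -/
theorem stmt6 {X Y : Type*} [Nonempty X] [Nonempty Y] (E : Setoid X) (F : Setoid Y) :
    (∃ φ : {α : X → X // α ∈ QEstar E} ≃ {β : Y → Y // β ∈ QEstar F},
        ∀ (a b : {α : X → X // α ∈ QEstar E}) (hab : rcomp a.1 b.1 ∈ QEstar E),
          ((φ ⟨rcomp a.1 b.1, hab⟩ : {β : Y → Y // β ∈ QEstar F}) : Y → Y) =
            rcomp ((φ a : {β : Y → Y // β ∈ QEstar F}) : Y → Y)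
              ((φ b : {β : Y → Y // β ∈ QEstar F}) : Y → Y))
      ↔ (Nonempty (Quotient E ≃ Quotient F) ∧
          Nonempty ((∀ q : Quotient E, {x : X // Quotient.mk E x = q}) ≃
            (∀ r : Quotient F, {y : Y // Quotient.mk F y = r}))) := by
  constructor
  · rintro ⟨φ, hφ⟩
    let ψ := ((QEstar.equivPair E).trans φ).trans (QEstar.equivPair F).symm
    have hψ : ∀ p q, ψ (rightGroupMul p q) = rightGroupMul (ψ p) (ψ q) := by
      intro p q
      apply (QEstar.equivPair F).injective
      apply Subtype.ext
      have hmul := QEstar.coe_equivPair_rightGroupMul p q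
      have hab : rcomp (QEstar.equivPair E p).1 (QEstar.equivPair E q).1 ∈ QEstar E :=
        hmul ▸ (QEstar.equivPair E (rightGroupMul p q)).2
      have h : QEstar.equivPair E (rightGroupMul p q) = ⟨_, hab⟩ := Subtype.ext hmul
      rw [QEstar.coe_equivPair_rightGroupMul]
      simp only [ψ, Equiv.trans_apply, Equiv.apply_symm_apply]
      rw [h, hφ]
    have : Nonempty (Transversal E) := ⟨fun q => ⟨q.out, q.out_eq⟩⟩
    obtain ⟨⟨g⟩, ht⟩ := nonempty_mulEquiv_and_equiv_of_rightGroup ψ hψ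
    have : Nonempty (Quotient E) := ‹Nonempty X›.map (Quotient.mk E)
    have : Nonempty (Quotient F) := ‹Nonempty Y›.map (Quotient.mk F)
    exact ⟨Equiv.Perm.nonempty_equiv_of_mulEquiv g, ht⟩
  · rintro ⟨⟨e⟩, ⟨t⟩⟩
    let ψ := Equiv.prodCongr e.permCongr t
    have hψ : ∀ p q, ψ (rightGroupMul p q) = rightGroupMul (ψ p) (ψ q) := by
      intro p q
      refine Prod.ext (Equiv.ext fun x => ?_) rfl
      simp [ψ, rightGroupMul]
    refine ⟨((QEstar.equivPair E).symm.trans ψ).trans (QEstar.equivPair F), fun a b hab => ?_⟩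
    obtain ⟨p, rfl⟩ := (QEstar.equivPair E).surjective a
    obtain ⟨q, rfl⟩ := (QEstar.equivPair E).surjective b
    have h : (⟨_, hab⟩ : {α : X → X // α ∈ QEstar E}) = QEstar.equivPair E (rightGroupMul p q) :=
      Subtype.ext (QEstar.coe_equivPair_rightGroupMul p q).symm
    rw [h]
    simp only [Equiv.trans_apply, Equiv.symm_apply_apply]
    rw [hψ, QEstar.coe_equivPair_rightGroupMul]
end

section
/- Let X be a finite nonempty set and E an equivalence relation on X with equivalence classes A₁, A₂, …, Aₙ, and let m = |A₁|·|A₂|⋯|Aₙ|. Then the cardinality of Q_{E^*}(X) equals n!·m. -/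
/-- The map that permutes the classes by `p.1` and then picks the point of the target class chosen
by the transversal `p.2`. -/
def permTransversalMap {X : Type*} (E : Setoid X)
    (p : Equiv.Perm (Quotient E) × ((q : Quotient E) → {x : X // Quotient.mk E x = q})) : X → X :=
  fun x => (p.2 (p.1 (Quotient.mk E x))).1

theorem mk_permTransversalMap {X : Type*} (E : Setoid X)
    (p : Equiv.Perm (Quotient E) × ((q : Quotient E) → {x : X // Quotient.mk E x = q})) (x : X) :
    Quotient.mk E (permTransversalMap E p x) = p.1 (Quotient.mk E x) :=
  (p.2 (p.1 (Quotient.mk E x))).2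

theorem permTransversalMap_mem_QEstar {X : Type*} (E : Setoid X)
    (p : Equiv.Perm (Quotient E) × ((q : Quotient E) → {x : X // Quotient.mk E x = q})) :
    permTransversalMap E p ∈ QEstar E := by
  refine ⟨fun x y => ?_, fun x y h => ?_, fun x => ?_⟩
  · rw [← Quotient.eq (r := E), ← Quotient.eq (r := E), mk_permTransversalMap,
      mk_permTransversalMap, p.1.apply_eq_iff_eq]
  · exact congrArg (fun q => (p.2 (p.1 q)).1) (Quotient.sound h)
  · obtain ⟨z, hz⟩ := Quotient.exists_rep (p.1.symm (Quotient.mk E x))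
    refine ⟨z, Quotient.exact (s := E) ?_⟩
    rw [mk_permTransversalMap, hz, Equiv.apply_symm_apply]

theorem permTransversalMap_injective {X : Type*} (E : Setoid X) :
    Function.Injective (permTransversalMap E) := by
  rintro ⟨σ, s⟩ ⟨τ, t⟩ h
  have hστ : σ = τ := by
    ext q
    induction q using Quotient.inductionOn with
    | h x =>
      rw [← mk_permTransversalMap E (σ, s), h, mk_permTransversalMap]
  subst hστ
  congr 1
  funext q
  obtain ⟨x, hx⟩ := Quotient.exists_rep (σ.symm q)
  obtain rfl : σ (Quotient.mk E x) = q := by rw [hx, Equiv.apply_symm_apply]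
  exact Subtype.ext (congrFun h x)

theorem exists_permTransversalMap_eq {X : Type*} (E : Setoid X) {α : X → X}
    (hα : α ∈ QEstar E) : ∃ p, permTransversalMap E p = α := by
  obtain ⟨hE, hconst, hmeet⟩ := hα
  let g : Quotient E → X := Quotient.lift α hconst
  have hg : Function.Bijective fun q => Quotient.mk E (g q) := by
    constructor
    · intro a b
      induction a, b using Quotient.inductionOn₂ with
      | h x y => exact fun h => Quotient.sound ((hE x y).2 (Quotient.exact h))
    · intro q
      induction q using Quotient.inductionOn with
      | h x =>
        obtain ⟨z, hz⟩ := hmeet x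
        exact ⟨Quotient.mk E z, (Quotient.sound hz).symm⟩
  let σ := Equiv.ofBijective _ hg
  refine ⟨(σ, fun q => ⟨g (σ.symm q), σ.apply_symm_apply q⟩), funext fun x => ?_⟩
  change g (σ.symm (σ (Quotient.mk E x))) = α x
  rw [σ.symm_apply_apply]
  rfl

/-- `Q_{E^*}(X)` is in bijection with pairs of a permutation of the classes and a transversal. -/
noncomputable def permTransversalEquiv {X : Type*} (E : Setoid X) :
    Equiv.Perm (Quotient E) × ((q : Quotient E) → {x : X // Quotient.mk E x = q}) ≃
      {α : X → X // α ∈ QEstar E} :=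
  Equiv.ofBijective (fun p => ⟨permTransversalMap E p, permTransversalMap_mem_QEstar E p⟩)
    ⟨fun _ _ h => permTransversalMap_injective E (congrArg Subtype.val h),
      fun ⟨_, hα⟩ => (exists_permTransversalMap_eq E hα).imp fun _ hp => Subtype.ext hp⟩

/-- if `X` is finite and nonempty with `n` equivalence classes `A₁, …, Aₙ` and
`m = |A₁|⋯|Aₙ|`, then `|Q_{E^*}(X)| = n! · m`. -/
theorem stmt7 {X : Type*} [Fintype X] [Nonempty X] (E : Setoid X)
    [Fintype (Quotient E)] :
    Nat.card {α : X → X // α ∈ QEstar E} =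
      (Nat.card (Quotient E)).factorial *
        ∏ q : Quotient E, Nat.card {x : X // Quotient.mk E x = q} := by
  rw [← Nat.card_congr (permTransversalEquiv E), Nat.card_prod, Nat.card_perm, Nat.card_pi]
end

section
/- Let S be a right group and let G ⊆ S be a generating set of S (i.e., the subsemigroup of S generated by G is all of S). Then for every idempotent e of S there exists g ∈ G with g·e = g (that is, G meets the maximal subgroup H_e = {x ∈ S : x·e = x} = S·e of S). -/
/-- if `G` generates a right group `S`, then for every idempotent `e` of `S`
there is `g ∈ G` with `g * e = g`, i.e. `G` meets the maximal subgroup `H_e`. -/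
theorem stmt8 {S : Type*} [Semigroup S] [Nonempty S]
    (hrg : ∀ a b : S, ∃! x : S, a * x = b)
    (G : Set S) (hG : Subsemigroup.closure G = ⊤)
    (e : S) (he : e * e = e) :
    ∃ g ∈ G, g * e = g := by
  have key : ∀ x ∈ Subsemigroup.closure G, x * e = x → ∃ g ∈ G, g * e = g := by
    intro x hx
    induction hx using Subsemigroup.closure_induction with
    | mem x hx => exact fun h => ⟨x, hx, h⟩
    | mul x y _ _ _ ihy =>
      exact fun h => ihy ((hrg x (x * y)).unique (by rw [← mul_assoc, h]) rfl)
  exact key e (hG ▸ Subsemigroup.mem_top e) he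
end

section
/- Let S be a right group and let G ⊆ S be a generating set of S (the subsemigroup generated by G equals S). Then there is an injection from the set E(S) of idempotents of S into G, given by sending each idempotent e to some g ∈ G with g·e = g; consequently |E(S)| ≤ |G|, and hence the rank of S (the least cardinality of a generating set) is at least |E(S)|. -/
/-- In a left cancellative semigroup, a right identity of some element of the subsemigroup generated
by `G` is a right identity of some element of `G`. -/
theorem exists_mem_mul_eq_self_of_mem_closure {S : Type*} [Semigroup S] [IsLeftCancelMul S]
    {G : Set S} {x e : S} (hx : x ∈ Subsemigroup.closure G) (hxe : x * e = x) :
    ∃ g ∈ G, g * e = g := by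
  induction hx using Subsemigroup.closure_induction with
  | mem x hx => exact ⟨x, hx, hxe⟩
  | mul x y _ _ _ ihy => exact ihy (mul_left_cancel (a := x) (by rw [← mul_assoc, hxe]))

/-- In a left cancellative semigroup, the idempotents inject into any generating set, each one
being a right identity of its image. -/
theorem exists_injective_idempotents_of_closure_eq_top {S : Type*} [Semigroup S]
    [IsLeftCancelMul S] {G : Set S} (hG : Subsemigroup.closure G = ⊤) :
    ∃ ι : {e : S // e * e = e} → G, Function.Injective ι ∧
      ∀ e : {e : S // e * e = e}, (ι e : S) * (e : S) = (ι e : S) := by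
  have h (e : {e : S // e * e = e}) : ∃ g : G, (g : S) * (e : S) = g := by
    obtain ⟨g, hg, hge⟩ :=
      exists_mem_mul_eq_self_of_mem_closure (G := G) (by simp [hG]) e.2
    exact ⟨⟨g, hg⟩, hge⟩
  choose ι hι using h
  refine ⟨ι, fun e f hef => Subtype.ext (mul_left_cancel (a := (ι e : S)) ?_), hι⟩
  rw [hι e, hef, hι f]

/-- if `G` generates a right group `S`, then there is an injection from the set
`E(S)` of idempotents into `G` sending each idempotent `e` to some `g ∈ G` with `g * e = g`;
consequently `|E(S)| ≤ |G|`, and the rank of `S` is at least `|E(S)|` (every generating set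
has cardinality at least `|E(S)|`). -/
theorem stmt9 {S : Type*} [Semigroup S] [Nonempty S]
    (hrg : ∀ a b : S, ∃! x : S, a * x = b)
    (G : Set S) (hG : Subsemigroup.closure G = ⊤) :
    (∃ ι : {e : S // e * e = e} → G, Function.Injective ι ∧
        ∀ e : {e : S // e * e = e}, (ι e : S) * (e : S) = (ι e : S)) ∧
    Cardinal.mk {e : S // e * e = e} ≤ Cardinal.mk G ∧
    ∀ H : Set S, Subsemigroup.closure H = ⊤ →
      Cardinal.mk {e : S // e * e = e} ≤ Cardinal.mk H := by
  have : IsLeftCancelMul S := ⟨fun a b c h => (hrg a (a * c)).unique h rfl⟩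
  have hle (H : Set S) (hH : Subsemigroup.closure H = ⊤) :
      Cardinal.mk {e : S // e * e = e} ≤ Cardinal.mk H :=
    let ⟨_, hι, _⟩ := exists_injective_idempotents_of_closure_eq_top hH
    Cardinal.mk_le_of_injective hι
  exact ⟨exists_injective_idempotents_of_closure_eq_top hG, hle G hG, hle⟩
end

section
/- Let S be a right group, let e be an idempotent of S, and let H_e = {x ∈ S : x·e = x} be the maximal subgroup of S with identity e. If G ⊆ H_e is such that every element of H_e is a product of elements of G (i.e., the subsemigroup of S generated by G contains H_e), then G ∪ E(S) generates S as a semigroup, where E(S) is the set of idempotents of S. -/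
/-- let `S` be a right group, `e` an idempotent, and
`H_e = {x | x * e = x}` the maximal subgroup with identity `e`. If `G ⊆ H_e` and every element
of `H_e` is a product of elements of `G`, then `G ∪ E(S)` generates `S`. -/
theorem stmt10 {S : Type*} [Semigroup S] [Nonempty S]
    (hrg : ∀ a b : S, ∃! x : S, a * x = b)
    (e : S) (he : e * e = e)
    (G : Set S) (hGsub : G ⊆ {x : S | x * e = x})
    (hgen : {x : S | x * e = x} ⊆ (Subsemigroup.closure G : Set S)) :
    Subsemigroup.closure (G ∪ {x : S | x * x = x}) = ⊤ := by
  refine eq_top_iff.mpr fun s _ => ?_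
  obtain ⟨f, hf, -⟩ := hrg s s
  have hff : f * f = f := (hrg s s).unique (by rw [← mul_assoc, hf, hf]) hf
  have hef : e * f = f := (hrg e (e * f)).unique (by rw [← mul_assoc, he]) rfl
  have hse : s * e ∈ Subsemigroup.closure G :=
    hgen (show s * e * e = s * e by rw [mul_assoc, he])
  have hs : s * e * f = s := by rw [mul_assoc, hef, hf]
  rw [← hs]
  exact mul_mem (Subsemigroup.closure_mono Set.subset_union_left hse)
    (Subsemigroup.subset_closure (Or.inr hff))
end

section
/- Let S be a right group, let e be an idempotent of S, and let H_e = {x ∈ S : x·e = x} be the maximal subgroup of S with identity e. Suppose G ⊆ H_e is a generating set of H_e of minimum cardinality (the subsemigroup generated by G equals H_e, and |G| ≤ |G'| for every G' ⊆ H_e whose generated subsemigroup equals H_e). Then the rank of S — the least cardinality of a subset of S whose generated subsemigroup equals S — equals max{|G|, |E(S)|}, where E(S) is the set of idempotents of S. -/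
namespace RightGroup

variable {S : Type*} [Semigroup S]

theorem idem_mul (hrg : ∀ a b : S, ∃! x : S, a * x = b) {i : S} (hi : i * i = i) (x : S) :
    i * x = x :=
  (hrg i (i * x)).unique (by rw [← mul_assoc, hi]) rfl

theorem idem_of_mul_eq_self (hrg : ∀ a b : S, ∃! x : S, a * x = b) {x y : S} (h : x * y = x) :
    y * y = y :=
  (hrg x x).unique (by rw [← mul_assoc, h, h]) h

theorem closure_image_mul_right (hrg : ∀ a b : S, ∃! x : S, a * x = b) {e : S}
    (he : e * e = e) {A : Set S} (hA : Subsemigroup.closure A = ⊤) :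
    (Subsemigroup.closure ((· * e) '' A) : Set S) = {x : S | x * e = x} := by
  have hmem : ∀ x ∈ Subsemigroup.closure A, x * e ∈ Subsemigroup.closure ((· * e) '' A) := by
    intro x hx
    induction hx using Subsemigroup.closure_induction with
    | mem x hx => exact Subsemigroup.subset_closure ⟨x, hx, rfl⟩
    | mul x y _ _ hx hy =>
      have h := mul_mem hx hy
      rwa [mul_assoc, idem_mul hrg he, ← mul_assoc] at h
  ext x
  constructor
  · intro hx
    induction hx using Subsemigroup.closure_induction with
    | mem x hx =>
      obtain ⟨a, -, rfl⟩ := hx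
      simp [mul_assoc, he]
    | mul x y _ _ _ hy =>
      change x * y * e = x * y
      rw [mul_assoc, hy]
  · intro (hx : x * e = x)
    have h := hmem x (hA ▸ Subsemigroup.mem_top x)
    rwa [hx] at h

theorem mk_idempotents_le (hrg : ∀ a b : S, ∃! x : S, a * x = b) {A : Set S}
    (hA : Subsemigroup.closure A = ⊤) :
    Cardinal.mk {x : S | x * x = x} ≤ Cardinal.mk A := by
  have hlast : ∀ x ∈ Subsemigroup.closure A, ∃ a ∈ A, ∀ y, a * y = a → x * y = x := by
    intro x hx
    induction hx using Subsemigroup.closure_induction with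
    | mem x hx => exact ⟨x, hx, fun _ h => h⟩
    | mul x y _ _ _ hy =>
      obtain ⟨a, ha, h⟩ := hy
      exact ⟨a, ha, fun z hz => by rw [mul_assoc, h z hz]⟩
  choose r hr using fun a : S => (hrg a a).exists
  refine Cardinal.mk_le_of_surjective
    (f := fun a : A => (⟨r a, idem_of_mul_eq_self hrg (hr a)⟩ : {x : S | x * x = x})) ?_
  rintro ⟨i, hi⟩
  obtain ⟨a, ha, h⟩ := hlast i (hA ▸ Subsemigroup.mem_top i)
  exact ⟨⟨a, ha⟩, Subtype.ext ((idem_mul hrg hi _).symm.trans (h _ (hr a)))⟩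

theorem closure_range_mul_eq_top (hrg : ∀ a b : S, ∃! x : S, a * x = b) {e : S}
    (he : e * e = e) {G : Set S}
    (hG : (Subsemigroup.closure G : Set S) = {x : S | x * e = x})
    {X : Type*} {p : X → G} {q : X → {x : S | x * x = x}}
    (hp : Function.Surjective p) (hq : Function.Surjective q) :
    Subsemigroup.closure (Set.range fun x => (p x : S) * (q x : S)) = ⊤ := by
  have hGe : ∀ g ∈ G, g * e = g := fun g hg => by
    have h : g ∈ (Subsemigroup.closure G : Set S) := Subsemigroup.subset_closure hg
    rwa [hG] at h
  have hlift : ∀ w ∈ Subsemigroup.closure G,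
      ∃ s ∈ Subsemigroup.closure (Set.range fun x => (p x : S) * (q x : S)), s * e = w := by
    intro w hw
    induction hw using Subsemigroup.closure_induction with
    | mem g hg =>
      obtain ⟨x, hx⟩ := hp ⟨g, hg⟩
      refine ⟨_, Subsemigroup.subset_closure ⟨x, rfl⟩, ?_⟩
      simp only [hx]
      rw [mul_assoc, idem_mul hrg (q x).2, hGe g hg]
    | mul v w _ _ hv hw =>
      obtain ⟨s, hs, rfl⟩ := hv
      obtain ⟨t, ht, rfl⟩ := hw
      exact ⟨s * t, mul_mem hs ht, by simp only [mul_assoc, idem_mul hrg he]⟩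
  refine (Subsemigroup.eq_top_iff' _).2 fun x => ?_
  obtain ⟨y, hy⟩ := (hrg x x).exists
  have hyy := idem_of_mul_eq_self hrg hy
  obtain ⟨k, hk⟩ := hq ⟨y, hyy⟩
  have hg := hGe _ (p k).2
  obtain ⟨z, hz⟩ := (hrg (p k : S) e).exists
  have hzg : z * (p k : S) = e :=
    (hrg (p k : S) (p k)).unique (by rw [← mul_assoc, hz, idem_mul hrg he]) hg
  have hw : x * z * e ∈ (Subsemigroup.closure G : Set S) := by
    rw [hG]
    change x * z * e * e = x * z * e
    rw [mul_assoc, he]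
  obtain ⟨s, hs, hse⟩ := hlift _ hw
  have hx : s * ((p k : S) * (q k : S)) = x := by
    calc s * ((p k : S) * (q k : S)) = s * e * ((p k : S) * (q k : S)) := by
          rw [mul_assoc, idem_mul hrg he]
      _ = x * (z * (p k : S) * (q k : S)) := by
          rw [hse]; simp only [mul_assoc, idem_mul hrg he]
      _ = x := by rw [hzg, hk, idem_mul hrg he, hy]
  rw [← hx]
  exact mul_mem hs (Subsemigroup.subset_closure ⟨k, rfl⟩)

end RightGroup


/-- let `S` be a right group, `e` an idempotent, `H_e = {x | x * e = x}` the
maximal subgroup with identity `e`, and `G ⊆ H_e` a generating set of `H_e` of minimum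
cardinality. Then the rank of `S` (the least cardinality of a subset generating `S` as a
semigroup) equals `max {|G|, |E(S)|}`. -/
theorem stmt11 {S : Type*} [Semigroup S] [Nonempty S]
    (hrg : ∀ a b : S, ∃! x : S, a * x = b)
    (e : S) (he : e * e = e)
    (G : Set S) (hGsub : G ⊆ {x : S | x * e = x})
    (hGgen : (Subsemigroup.closure G : Set S) = {x : S | x * e = x})
    (hGmin : ∀ G' : Set S, G' ⊆ {x : S | x * e = x} →
        (Subsemigroup.closure G' : Set S) = {x : S | x * e = x} →
        Cardinal.mk G ≤ Cardinal.mk G') :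
    sInf {c : Cardinal | ∃ H : Set S, Subsemigroup.closure H = ⊤ ∧ Cardinal.mk H = c}
      = max (Cardinal.mk G) (Cardinal.mk {x : S | x * x = x}) := by
  have hGne : Nonempty G := by
    by_contra h
    have hG : G = ∅ := Set.not_nonempty_iff_eq_empty.1 fun ⟨g, hg⟩ => h ⟨⟨g, hg⟩⟩
    have hmem : e ∈ (Subsemigroup.closure G : Set S) := by rw [hGgen]; exact he
    rw [hG, Subsemigroup.closure_empty] at hmem
    exact hmem
  have hEne : Nonempty {x : S | x * x = x} := ⟨⟨e, he⟩⟩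
  apply le_antisymm
  · rcases le_total (Cardinal.mk G) (Cardinal.mk {x : S | x * x = x}) with h | h
    · rw [max_eq_right h]
      obtain ⟨f⟩ := h
      exact le_trans (csInf_le' ⟨_, RightGroup.closure_range_mul_eq_top hrg he hGgen
        (Function.invFun_surjective f.injective) Function.surjective_id, rfl⟩)
        Cardinal.mk_range_le
    · rw [max_eq_left h]
      obtain ⟨f⟩ := h
      exact le_trans (csInf_le' ⟨_, RightGroup.closure_range_mul_eq_top hrg he hGgen
        Function.surjective_id (Function.invFun_surjective f.injective), rfl⟩)
        Cardinal.mk_range_le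
  · refine le_csInf ⟨_, ⊤, Subsemigroup.closure_univ, rfl⟩ ?_
    rintro _ ⟨A, hA, rfl⟩
    have himage := RightGroup.closure_image_mul_right hrg he hA
    exact max_le
      ((hGmin _ (himage ▸ Subsemigroup.subset_closure) himage).trans Cardinal.mk_image_le)
      (RightGroup.mk_idempotents_le hrg hA)
end

section
/- Let G be a finite group, let E be a nonempty right zero semigroup, and let S = G × E be their product semigroup. Let T be a subsemigroup of S and let e be an idempotent of S. If T·e = S·e (as subsets of S, where T·e = {t·e : t ∈ T}) and the set of idempotents of S lying in T equals the set of all idempotents of S, then T = S. -/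
/-- let `G` be a finite group, `E` a nonempty right zero semigroup and
`S = G × E` their product semigroup. If `T` is a subsemigroup of `S` and `e` is an idempotent
of `S` such that `T·e = S·e` and the idempotents lying in `T` are all the idempotents of `S`,
then `T = S`. -/
theorem stmt15 {G E : Type*} [Group G] [Fintype G] [Semigroup E] [Nonempty E]
    (hE : ∀ a b : E, a * b = b)
    (T : Subsemigroup (G × E)) (e : G × E) (he : e * e = e)
    (h1 : {x : G × E | ∃ t ∈ T, t * e = x} = {x : G × E | ∃ s : G × E, s * e = x})
    (h2 : {x : G × E | x ∈ T ∧ x * x = x} = {x : G × E | x * x = x}) :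
    T = ⊤ := by
  have he1 : e.1 = 1 := mul_eq_left.mp (congrArg Prod.fst he)
  refine (Subsemigroup.eq_top_iff' T).mpr fun x => ?_
  obtain ⟨t, ht, hte⟩ : x * e ∈ {x : G × E | ∃ t ∈ T, t * e = x} := h1 ▸ ⟨x, rfl⟩
  have htx : t.1 = x.1 := by simpa [he1] using congrArg Prod.fst hte
  have hidem : ((1, x.2) : G × E) ∈ {x : G × E | x ∈ T ∧ x * x = x} :=
    h2 ▸ Prod.ext (mul_one 1) (hE _ _)
  have hx : t * (1, x.2) = x := Prod.ext (by simp [htx]) (hE _ _)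
  exact hx ▸ T.mul_mem ht hidem.1
end

section
/- Let G be a finite group and let E be a right zero semigroup with at least two elements, and let S = G × E be their product semigroup. A subsemigroup T of S is a maximal proper subsemigroup of S if and only if either T = H × E (as a set) for some maximal subgroup H of G, or T = G × F (as a set) for some maximal proper subsemigroup F of E (equivalently, by the description of maximal subsemigroups of right zero semigroups, F = E \ {e} for some e ∈ E). -/
/-- A nonempty subsemigroup of a finite group is the carrier of a subgroup. -/
theorem Subsemigroup.exists_subgroup_coe_eq {G : Type*} [Group G] [Finite G]
    (P : Subsemigroup G) (hP : (P : Set G).Nonempty) :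
    ∃ H : Subgroup G, (H : Set G) = P := by
  have hpow (g : G) (hg : g ∈ P) (n : ℕ) : g ^ (n + 1) ∈ P := by
    induction n with
    | zero => simpa using hg
    | succ n ih => exact pow_succ g (n + 1) ▸ P.mul_mem ih hg
  have hone : (1 : G) ∈ P := by
    obtain ⟨g, hg⟩ := hP
    have h := hpow g hg (orderOf g - 1)
    rwa [Nat.sub_add_cancel (orderOf_pos g), pow_orderOf_eq_one] at h
  refine ⟨{ carrier := P, mul_mem' := P.mul_mem, one_mem' := hone, inv_mem' := ?_ }, rfl⟩
  intro g hg
  have hinv : g⁻¹ = g ^ (orderOf g - 1) :=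
    inv_eq_of_mul_eq_one_left (by
      rw [← pow_succ, Nat.sub_add_cancel (orderOf_pos g), pow_orderOf_eq_one])
  change g⁻¹ ∈ P
  rw [hinv]
  cases orderOf g - 1 with
  | zero => simpa using hone
  | succ n => exact hpow g hg n

/-- A subset of a right zero semigroup, as a subsemigroup. -/
def Subsemigroup.ofRightZero {E : Type*} [Semigroup E] (hE : ∀ a b : E, a * b = b) (s : Set E) :
    Subsemigroup E where
  carrier := s
  mul_mem' {a b} _ hb := (hE a b).symm ▸ hb

/-- A maximal proper subsemigroup of a nontrivial semigroup with an idempotent is nonempty. -/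
theorem Subsemigroup.nonempty_of_maximal {S : Type*} [Semigroup S] [Nontrivial S]
    {x : S} (hx : x * x = x) {F : Subsemigroup S}
    (hF : ∀ N : Subsemigroup S, F < N → N = ⊤) : (F : Set S).Nonempty := by
  rw [Set.nonempty_iff_ne_empty]
  intro h
  have hmem (y : S) : y ∉ F := fun hy => by simpa [h] using (show y ∈ (F : Set S) from hy)
  let N : Subsemigroup S :=
    { carrier := {x}
      mul_mem' := by rintro _ _ rfl rfl; exact hx }
  have hN : N = ⊤ := hF N <| SetLike.lt_iff_le_and_exists.2
    ⟨fun y hy => (hmem y hy).elim, x, rfl, hmem x⟩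
  obtain ⟨y, hy⟩ := exists_ne x
  exact hy (show y ∈ N from hN ▸ Subsemigroup.mem_top y)

/-- A nonempty subsemigroup of the product of a finite group and a right zero semigroup is a
product of a subgroup and a nonempty subsemigroup. -/
theorem Subsemigroup.exists_eq_prod_of_rightZero {G E : Type*} [Group G] [Finite G] [Semigroup E]
    (hE : ∀ a b : E, a * b = b) (T : Subsemigroup (G × E)) (hT : (T : Set (G × E)).Nonempty) :
    ∃ (H : Subgroup G) (F : Subsemigroup E), (F : Set E).Nonempty ∧
      ∀ g e, (g, e) ∈ T ↔ g ∈ H ∧ e ∈ F := by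
  obtain ⟨⟨g₀, e₀⟩, h₀⟩ := hT
  obtain ⟨H, hH⟩ := (T.map (MulHom.fst G E)).exists_subgroup_coe_eq
    ⟨g₀, Subsemigroup.mem_map.2 ⟨_, h₀, rfl⟩⟩
  have hmem (g : G) : g ∈ H ↔ ∃ e, (g, e) ∈ T := by
    rw [← SetLike.mem_coe, hH]
    simp
  refine ⟨H, ofRightZero hE {e | ∃ g, (g, e) ∈ T}, ⟨e₀, g₀, h₀⟩, fun g e =>
    ⟨fun h => ⟨(hmem g).2 ⟨e, h⟩, g, h⟩, ?_⟩⟩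
  rintro ⟨hg, k, hk⟩
  obtain ⟨f, hf⟩ := (hmem _).1 (H.mul_mem hg (H.inv_mem ((hmem k).2 ⟨e, hk⟩)))
  simpa [hE] using T.mul_mem hf hk


/-- let `G` be a finite group, `E` a right zero semigroup with at least two
elements, and `S = G × E` their product semigroup. A subsemigroup `T` of `S` is a maximal
proper subsemigroup if and only if `T = H × E` for some maximal subgroup `H` of `G`, or
`T = G × F` for some maximal proper subsemigroup `F` of `E`. -/
theorem stmt17 {G E : Type*} [Group G] [Fintype G] [Semigroup E] [Nontrivial E]
    (hE : ∀ a b : E, a * b = b)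
    (T : Subsemigroup (G × E)) :
    (T ≠ ⊤ ∧ ∀ N : Subsemigroup (G × E), T < N → N = ⊤) ↔
      ((∃ H : Subgroup G, (H ≠ ⊤ ∧ ∀ K : Subgroup G, H < K → K = ⊤) ∧
          (T : Set (G × E)) = (H : Set G) ×ˢ (Set.univ : Set E)) ∨
       (∃ F : Subsemigroup E, (F ≠ ⊤ ∧ ∀ N : Subsemigroup E, F < N → N = ⊤) ∧
          (T : Set (G × E)) = (Set.univ : Set G) ×ˢ (F : Set E))) := by
  have hT_iff (H : Set G) (F : Set E) : (T : Set (G × E)) = H ×ˢ F ↔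
      ∀ g e, (g, e) ∈ T ↔ g ∈ H ∧ e ∈ F := by
    simp [Set.ext_iff]
  simp only [hT_iff, SetLike.mem_coe, Set.mem_univ, and_true, true_and]
  obtain ⟨e₀⟩ : Nonempty E := inferInstance
  constructor
  · rintro ⟨hne, hmax⟩
    obtain ⟨H, F, ⟨f, hf⟩, hT⟩ := T.exists_eq_prod_of_rightZero hE
      (Subsemigroup.nonempty_of_maximal (x := (1, e₀)) (by simp [hE]) hmax)
    by_cases hH : H = ⊤
    · subst hH
      simp only [Subgroup.mem_top, true_and] at hT
      refine Or.inr ⟨F, ⟨?_, fun N hN => ?_⟩, hT⟩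
      · rintro rfl
        exact hne (by ext ⟨g, e⟩; simp [hT])
      · obtain ⟨hle, e, heN, heF⟩ := SetLike.lt_iff_le_and_exists.1 hN
        have htop := hmax (N.comap (MulHom.snd G E)) <| SetLike.lt_iff_le_and_exists.2
          ⟨fun x hx => hle ((hT x.1 x.2).1 hx), (1, e), heN, fun h => heF ((hT 1 e).1 h)⟩
        refine (Subsemigroup.eq_top_iff' N).2 fun y => ?_
        exact (Subsemigroup.eq_top_iff' _).1 htop (1, y)
    · have hproper (K : Subgroup G) (hK : H ≤ K) (hKT : K ≠ ⊤) (g : G) (e : E) (hg : g ∈ K) :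
          (g, e) ∈ T := by
        by_contra hgT
        have htop := hmax (K.toSubmonoid.toSubsemigroup.comap (MulHom.fst G E)) <|
          SetLike.lt_iff_le_and_exists.2
            ⟨fun x hx => hK ((hT x.1 x.2).1 hx).1, (g, e), hg, hgT⟩
        refine hKT ((Subgroup.eq_top_iff' K).2 fun y => ?_)
        exact (Subsemigroup.eq_top_iff' _).1 htop (y, e)
      refine Or.inl ⟨H, ⟨hH, fun K hK => ?_⟩, fun g e =>
        ⟨fun h => ((hT g e).1 h).1, hproper H le_rfl hH g e⟩⟩
      by_contra hKT
      exact hK.not_ge fun g hg => ((hT g f).1 (hproper K hK.le hKT g f hg)).1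
  · rintro (⟨H, ⟨hne, hmax⟩, hT⟩ | ⟨F, ⟨hne, hmax⟩, hT⟩)
    · refine ⟨?_, fun N hN => ?_⟩
      · rintro rfl
        exact hne ((Subgroup.eq_top_iff' H).2 fun g => (hT g e₀).1 trivial)
      · obtain ⟨hle, ⟨g, e⟩, hgN, hgT⟩ := SetLike.lt_iff_le_and_exists.1 hN
        obtain ⟨K, F, -, hNmem⟩ := N.exists_eq_prod_of_rightZero hE ⟨_, hgN⟩
        have hHK (x : G) (hx : x ∈ H) (y : E) : x ∈ K ∧ y ∈ F :=
          (hNmem x y).1 (hle ((hT x y).2 hx))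
        have hK : K = ⊤ := hmax K <| SetLike.lt_iff_le_and_exists.2
          ⟨fun x hx => (hHK x hx e₀).1, g, ((hNmem g e).1 hgN).1, fun h => hgT ((hT g e).2 h)⟩
        ext ⟨x, y⟩
        simp [hNmem, hK, (hHK 1 H.one_mem y).2]
    · obtain ⟨f, hf⟩ := Subsemigroup.nonempty_of_maximal (hE e₀ e₀) hmax
      refine ⟨?_, fun N hN => ?_⟩
      · rintro rfl
        exact hne ((Subsemigroup.eq_top_iff' F).2 fun e => (hT 1 e).1 trivial)
      · obtain ⟨hle, ⟨g, e⟩, hgN, hgT⟩ := SetLike.lt_iff_le_and_exists.1 hN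
        obtain ⟨K, F', -, hNmem⟩ := N.exists_eq_prod_of_rightZero hE ⟨_, hgN⟩
        have hKF (x : G) (y : E) (hy : y ∈ F) : x ∈ K ∧ y ∈ F' :=
          (hNmem x y).1 (hle ((hT x y).2 hy))
        have hF' : F' = ⊤ := hmax F' <| SetLike.lt_iff_le_and_exists.2
          ⟨fun y hy => (hKF 1 y hy).2, e, ((hNmem g e).1 hgN).2, fun h => hgT ((hT g e).2 h)⟩
        ext ⟨x, y⟩
        simp [hNmem, hF', (hKF x f hf).1]
end

section
/- Let G be a finite group, let E be a nonempty right zero semigroup, and let S = G × E be their product semigroup. Then every nonempty subsemigroup T of S is the direct product of its projections: writing H = {g ∈ G : (g,f) ∈ T for some f ∈ E} and F = {f ∈ E : (g,f) ∈ T for some g ∈ G}, the set H is a subgroup of G, F is a (right zero) subsemigroup of E, and T = H × F as a set. -/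
/-- Powers of an element of a subsemigroup of `G × E`, with `E` right zero, keep the second
coordinate. -/
theorem pow_succ_mk_mem {G E : Type*} [Group G] [Semigroup E] (hE : ∀ a b : E, a * b = b)
    {T : Subsemigroup (G × E)} {g : G} {f : E} (h : (g, f) ∈ T) (n : ℕ) :
    (g ^ (n + 1), f) ∈ T := by
  induction n with
  | zero => simpa using h
  | succ n ih => simpa [pow_succ, hE] using T.mul_mem ih h

theorem one_mk_mem {G E : Type*} [Group G] [Finite G] [Semigroup E] (hE : ∀ a b : E, a * b = b)
    {T : Subsemigroup (G × E)} {g : G} {f : E} (h : (g, f) ∈ T) : (1, f) ∈ T := by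
  obtain ⟨n, hn⟩ := Nat.exists_eq_add_one.mpr (orderOf_pos g)
  simpa [← hn, pow_orderOf_eq_one] using pow_succ_mk_mem hE h n

theorem inv_mk_mem {G E : Type*} [Group G] [Finite G] [Semigroup E] (hE : ∀ a b : E, a * b = b)
    {T : Subsemigroup (G × E)} {g : G} {f : E} (h : (g, f) ∈ T) : (g⁻¹, f) ∈ T := by
  obtain ⟨n, hn⟩ := Nat.exists_eq_add_one.mpr (orderOf_pos g)
  have key : g ^ (n + n + 1) = g⁻¹ := by
    have hone : g ^ (n + 1) = 1 := hn ▸ pow_orderOf_eq_one g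
    rw [add_assoc, pow_add, hone, mul_one, eq_inv_iff_mul_eq_one, ← pow_succ, hone]
  exact key ▸ pow_succ_mk_mem hE h (n + n)


/-- let `G` be a finite group, `E` a nonempty right zero semigroup and
`S = G × E` their product semigroup. Every nonempty subsemigroup `T` of `S` is the direct
product of its projections: the projection `H` to `G` is a subgroup of `G`, the projection `F`
to `E` is a (right zero) subsemigroup of `E`, and `T = H × F` as a set. -/
theorem stmt18 {G E : Type*} [Group G] [Fintype G] [Semigroup E] [Nonempty E]
    (hE : ∀ a b : E, a * b = b)
    (T : Subsemigroup (G × E)) (hT : (T : Set (G × E)).Nonempty) :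
    (∃ H : Subgroup G, (H : Set G) = {g : G | ∃ f : E, (g, f) ∈ T}) ∧
    (∀ a ∈ {f : E | ∃ g : G, (g, f) ∈ T}, ∀ b ∈ {f : E | ∃ g : G, (g, f) ∈ T},
        a * b ∈ {f : E | ∃ g : G, (g, f) ∈ T}) ∧
    (T : Set (G × E)) = {g : G | ∃ f : E, (g, f) ∈ T} ×ˢ {f : E | ∃ g : G, (g, f) ∈ T} := by
  refine ⟨⟨{ carrier := {g : G | ∃ f : E, (g, f) ∈ T}
             one_mem' := ?_
             mul_mem' := ?_
             inv_mem' := ?_ }, rfl⟩, ?_, ?_⟩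
  · rintro a b ⟨e, ha⟩ ⟨f, hb⟩
    exact ⟨e * f, T.mul_mem ha hb⟩
  · obtain ⟨⟨g, f⟩, h⟩ := hT
    exact ⟨f, one_mk_mem hE h⟩
  · rintro g ⟨f, h⟩
    exact ⟨f, inv_mk_mem hE h⟩
  · rintro a - b hb
    rwa [hE]
  · ext ⟨g, f⟩
    constructor
    · exact fun h => ⟨⟨f, h⟩, ⟨g, h⟩⟩
    · rintro ⟨⟨e, he⟩, ⟨k, hk⟩⟩
      simpa [hE] using T.mul_mem he (one_mk_mem hE hk)
end

section
/- Let X be a finite nonempty set and let E be an equivalence relation on X which is not the identity relation. Let n = |X/E| be the number of E-classes A₁, …, Aₙ and let m = |A₁|·|A₂|⋯|Aₙ|. Then the number of maximal proper subsemigroups of Q_{E^*}(X) equals sₙ + m, where sₙ is the number of maximal subgroups of the symmetric group on X/E (equivalently, of the symmetric group of degree n). -/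
/-- `M` is a maximal proper subset of `U` among those closed under `op`. -/
def IsMaximalClosedIn {Y : Type*} (op : Y → Y → Y) (U M : Set Y) : Prop :=
  M ⊆ U ∧ (∀ a ∈ M, ∀ b ∈ M, op a b ∈ M) ∧ M ≠ U ∧
    ∀ N : Set Y, N ⊆ U → (∀ a ∈ N, ∀ b ∈ N, op a b ∈ N) → M ⊂ N → N = U

/-- A closed set containing `M` is either `M` or the whole of `U`. -/
theorem IsMaximalClosedIn.eq_or_eq {Y : Type*} {op : Y → Y → Y} {U M N : Set Y}
    (h : IsMaximalClosedIn op U M) (hNU : N ⊆ U) (hN : ∀ a ∈ N, ∀ b ∈ N, op a b ∈ N)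
    (hMN : M ⊆ N) : N = M ∨ N = U := by
  rcases hMN.eq_or_ssubset with h' | h'
  · exact Or.inl h'.symm
  · exact Or.inr (h.2.2.2 N hNU hN h')

section RightGroup

/-! In this section `f` identifies `range f` with the right group `Gᵐᵒᵖ × R`, where `R` carries
the right zero multiplication. -/

variable {G R Y : Type*} [Group G] {op : Y → Y → Y} {f : G × R → Y}

theorem image_prod_closed (hop : ∀ a b, op (f a) (f b) = f (b.1 * a.1, b.2))
    (H : Subgroup G) (T : Set R) :
    ∀ a ∈ f '' ((H : Set G) ×ˢ T), ∀ b ∈ f '' ((H : Set G) ×ˢ T),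
      op a b ∈ f '' ((H : Set G) ×ˢ T) := by
  rintro _ ⟨a, ha, rfl⟩ _ ⟨b, hb, rfl⟩
  rw [hop]
  exact Set.mem_image_of_mem f ⟨H.mul_mem hb.1 ha.1, hb.2⟩

theorem mem_image_prod_iff (hf : Function.Injective f) {H : Subgroup G} {T : Set R}
    {g : G} {r : R} : f (g, r) ∈ f '' ((H : Set G) ×ˢ T) ↔ g ∈ H ∧ r ∈ T := by
  rw [hf.mem_set_image, Set.mem_prod, SetLike.mem_coe]

theorem image_prod_eq_range_iff (hf : Function.Injective f) [Nonempty R] {H : Subgroup G}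
    {T : Set R} : f '' ((H : Set G) ×ˢ T) = Set.range f ↔ H = ⊤ ∧ T = Set.univ := by
  constructor
  · intro h
    have key : ∀ g r, g ∈ H ∧ r ∈ T := fun g r =>
      (mem_image_prod_iff hf).1 (h ▸ Set.mem_range_self (g, r))
    obtain ⟨r⟩ := ‹Nonempty R›
    exact ⟨(Subgroup.eq_top_iff' H).2 fun g => (key g r).1,
      Set.eq_univ_of_forall fun s => (key 1 s).2⟩
  · rintro ⟨rfl, rfl⟩
    simp

/-- A nonempty subsemigroup of a finite right group is a product of a subgroup and a set. -/
theorem exists_eq_image_prod [Finite G]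
    (hop : ∀ a b, op (f a) (f b) = f (b.1 * a.1, b.2)) {M : Set Y} (hM : M ⊆ Set.range f)
    (hcl : ∀ a ∈ M, ∀ b ∈ M, op a b ∈ M) (hne : M.Nonempty) :
    ∃ (H : Subgroup G) (T : Set R), M = f '' ((H : Set G) ×ˢ T) := by
  have hmul {g h : G} {r s : R} (hg : f (g, r) ∈ M) (hh : f (h, s) ∈ M) :
      f (h * g, s) ∈ M := by
    simpa only [hop] using hcl _ hg _ hh
  have hpow {g h : G} {s : R} (hg : f (g, s) ∈ M) (hh : f (h, s) ∈ M) (k : ℕ) :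
      f (h ^ k * g, s) ∈ M := by
    induction k with
    | zero => simpa using hg
    | succ k ih => simpa [pow_succ', mul_assoc] using hmul ih hh
  have hswap {g h : G} {r s : R} (hg : f (g, r) ∈ M) (hh : f (h, s) ∈ M) : f (g, s) ∈ M := by
    have := hpow (hmul hg hh) hh (orderOf h - 1)
    rwa [← mul_assoc, ← pow_succ, Nat.sub_add_cancel (orderOf_pos h), pow_orderOf_eq_one,
      one_mul] at this
  obtain ⟨y, hy⟩ := hne
  obtain ⟨⟨g₀, r₀⟩, rfl⟩ := hM hy
  have hinv {g : G} (hg : f (g, r₀) ∈ M) : f (g⁻¹, r₀) ∈ M := by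
    have hpos := orderOf_pos g
    have h : g ^ (orderOf g * 2 - 2) * g = g⁻¹ := by
      rw [eq_inv_iff_mul_eq_one, ← pow_succ, ← pow_succ,
        show orderOf g * 2 - 2 + 1 + 1 = orderOf g * 2 by omega, pow_mul, pow_orderOf_eq_one,
        one_pow]
    exact h ▸ hpow hg hg (orderOf g * 2 - 2)
  refine ⟨{ carrier := {g | f (g, r₀) ∈ M}
            mul_mem' := fun ha hb => hmul hb ha
            one_mem' := by simpa using hmul (hinv hy) hy
            inv_mem' := hinv }, {r | f (g₀, r) ∈ M}, ?_⟩
  ext y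
  constructor
  · intro h
    obtain ⟨⟨g, r⟩, rfl⟩ := hM h
    exact ⟨(g, r), ⟨hswap h hy, hswap hy h⟩, rfl⟩
  · rintro ⟨⟨g, r⟩, ⟨hg, hr⟩, rfl⟩
    exact hswap hg hr

theorem isMaximalClosedIn_image_prod_univ [Finite G] [Nonempty R] (hf : Function.Injective f)
    (hop : ∀ a b, op (f a) (f b) = f (b.1 * a.1, b.2)) {H : Subgroup G} (hH : IsCoatom H) :
    IsMaximalClosedIn op (Set.range f) (f '' ((H : Set G) ×ˢ Set.univ)) := by
  refine ⟨Set.image_subset_range _ _, image_prod_closed hop _ _,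
    fun h => hH.1 ((image_prod_eq_range_iff hf).1 h).1, fun N hN hcl hlt => ?_⟩
  obtain ⟨r⟩ := ‹Nonempty R›
  obtain ⟨K, T, rfl⟩ := exists_eq_image_prod hop hN hcl
    ⟨f (1, r), hlt.1 ((mem_image_prod_iff hf).2 ⟨H.one_mem, trivial⟩)⟩
  have hsub {g : G} {r : R} (hg : g ∈ H) : g ∈ K ∧ r ∈ T :=
    (mem_image_prod_iff hf).1 (hlt.1 ((mem_image_prod_iff hf).2 ⟨hg, trivial⟩))
  obtain rfl : T = Set.univ := Set.eq_univ_of_forall fun s => (hsub H.one_mem).2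
  have : Nonempty R := ⟨r⟩
  refine (image_prod_eq_range_iff hf).2
    ⟨hH.2 K (lt_of_le_of_ne (fun g hg => (hsub (r := r) hg).1) ?_), rfl⟩
  rintro rfl
  exact hlt.ne rfl

theorem isMaximalClosedIn_image_prod_compl [Finite G] [Nontrivial R] (hf : Function.Injective f)
    (hop : ∀ a b, op (f a) (f b) = f (b.1 * a.1, b.2)) (r : R) :
    IsMaximalClosedIn op (Set.range f) (f '' (((⊤ : Subgroup G) : Set G) ×ˢ {r}ᶜ)) := by
  refine ⟨Set.image_subset_range _ _, image_prod_closed hop _ _,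
    fun h => ?_, fun N hN hcl hlt => ?_⟩
  · have := ((image_prod_eq_range_iff hf).1 h).2
    exact (this ▸ Set.mem_univ r : r ∈ ({r}ᶜ : Set R)) rfl
  obtain ⟨s, hs⟩ := exists_ne r
  obtain ⟨K, T, rfl⟩ := exists_eq_image_prod hop hN hcl
    ⟨f (1, s), hlt.1 ((mem_image_prod_iff hf).2 ⟨Subgroup.mem_top _, hs⟩)⟩
  have hsub {g : G} {s : R} (hs : s ≠ r) : g ∈ K ∧ s ∈ T :=
    (mem_image_prod_iff hf).1 (hlt.1 ((mem_image_prod_iff hf).2 ⟨Subgroup.mem_top _, hs⟩))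
  obtain rfl : K = ⊤ := (Subgroup.eq_top_iff' K).2 fun g => (hsub hs).1
  refine (image_prod_eq_range_iff hf).2 ⟨rfl, Set.eq_univ_of_forall fun t => ?_⟩
  by_contra ht
  refine hlt.2 (Set.image_mono (Set.prod_mono_right fun u hu => ?_))
  rintro rfl
  by_cases htu : t = u
  · exact ht (htu ▸ hu)
  · exact ht (hsub (g := 1) htu).2

theorem IsMaximalClosedIn.eq_image_prod [Finite G] [Nontrivial R] (hf : Function.Injective f)
    (hop : ∀ a b, op (f a) (f b) = f (b.1 * a.1, b.2)) {M : Set Y}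
    (hM : IsMaximalClosedIn op (Set.range f) M) :
    (∃ H : Subgroup G, IsCoatom H ∧ M = f '' ((H : Set G) ×ˢ Set.univ)) ∨
      ∃ r, M = f '' (((⊤ : Subgroup G) : Set G) ×ˢ {r}ᶜ) := by
  have hcompl {r : R} (h : M ⊆ f '' (((⊤ : Subgroup G) : Set G) ×ˢ {r}ᶜ)) :
      M = f '' (((⊤ : Subgroup G) : Set G) ×ˢ {r}ᶜ) :=
    have hmax := isMaximalClosedIn_image_prod_compl hf hop r
    (hM.eq_or_eq hmax.1 hmax.2.1 h).elim Eq.symm fun h => absurd h hmax.2.2.1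
  rcases M.eq_empty_or_nonempty with rfl | hne
  · obtain ⟨r⟩ : Nonempty R := inferInstance
    exact Or.inr ⟨r, hcompl (Set.empty_subset _)⟩
  obtain ⟨H, T, rfl⟩ := exists_eq_image_prod hop hM.1 hM.2.1 hne
  by_cases hH : H = ⊤
  · subst hH
    have hT : T ≠ Set.univ := fun h => hM.2.2.1 ((image_prod_eq_range_iff hf).2 ⟨rfl, h⟩)
    obtain ⟨r, hr⟩ := (Set.ne_univ_iff_exists_notMem T).1 hT
    exact Or.inr ⟨r, hcompl (Set.image_mono (Set.prod_mono_right
      (Set.subset_compl_singleton_iff.2 hr)))⟩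
  · have huniv {K : Subgroup G} (hK : H ≤ K) :=
      hM.eq_or_eq (Set.image_subset_range f ((K : Set G) ×ˢ Set.univ))
        (image_prod_closed hop K Set.univ)
        (Set.image_mono (Set.prod_mono hK (Set.subset_univ T)))
    have hMH := (huniv le_rfl).resolve_right fun h => hH ((image_prod_eq_range_iff hf).1 h).1
    refine Or.inl ⟨H, ⟨hH, fun K hK => ?_⟩, hMH.symm⟩
    rcases huniv hK.le with h | h
    · obtain ⟨r⟩ : Nonempty R := inferInstance
      refine absurd (fun g hg => ?_) hK.not_ge
      have hg' : f (g, r) ∈ f '' ((K : Set G) ×ˢ Set.univ) :=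
        (mem_image_prod_iff hf).2 ⟨hg, trivial⟩
      rw [h] at hg'
      exact ((mem_image_prod_iff hf).1 hg').1
    · exact ((image_prod_eq_range_iff hf).1 h).1

/-- The number of maximal subsemigroups of a finite right group whose right zero factor is
nontrivial. -/
theorem card_isMaximalClosedIn_range [Finite G] [Finite R] [Nontrivial R]
    (hf : Function.Injective f) (hop : ∀ a b, op (f a) (f b) = f (b.1 * a.1, b.2)) :
    Nat.card {M : Set Y // IsMaximalClosedIn op (Set.range f) M} =
      Nat.card {H : Subgroup G // IsCoatom H} + Nat.card R := by
  let Φ : {H : Subgroup G // IsCoatom H} ⊕ R → {M // IsMaximalClosedIn op (Set.range f) M} :=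
    Sum.elim (fun H => ⟨_, isMaximalClosedIn_image_prod_univ hf hop H.2⟩)
      (fun r => ⟨_, isMaximalClosedIn_image_prod_compl hf hop r⟩)
  have hinl_inr (H : {H : Subgroup G // IsCoatom H}) (r : R) : Φ (.inl H) ≠ Φ (.inr r) := by
    intro h
    have h1 : f (1, r) ∈ f '' ((H.1 : Set G) ×ˢ Set.univ) :=
      (mem_image_prod_iff hf).2 ⟨H.1.one_mem, trivial⟩
    rw [show f '' ((H.1 : Set G) ×ˢ Set.univ) = _ from congrArg Subtype.val h] at h1
    exact ((mem_image_prod_iff hf).1 h1).2 rfl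
  have hinj : Function.Injective Φ := by
    rintro (H | r) (K | s) h
    · obtain ⟨r⟩ : Nonempty R := inferInstance
      have h' : f '' ((H.1 : Set G) ×ˢ Set.univ) = f '' ((K.1 : Set G) ×ˢ Set.univ) :=
        congrArg Subtype.val h
      refine congrArg Sum.inl (Subtype.ext (Subgroup.ext fun g => ?_))
      have hg := Set.ext_iff.1 h' (f (g, r))
      simpa [mem_image_prod_iff hf] using hg
    · exact absurd h (hinl_inr H s)
    · exact absurd h.symm (hinl_inr K r)
    · have h' : f '' (((⊤ : Subgroup G) : Set G) ×ˢ {r}ᶜ) =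
          f '' (((⊤ : Subgroup G) : Set G) ×ˢ {s}ᶜ) := congrArg Subtype.val h
      have hr := Set.ext_iff.1 h' (f (1, r))
      rw [mem_image_prod_iff hf, mem_image_prod_iff hf] at hr
      refine congrArg Sum.inr (not_not.1 fun hrs => ?_)
      exact (hr.2 ⟨Subgroup.mem_top _, hrs⟩).2 rfl
  have hsurj : Function.Surjective Φ := by
    rintro ⟨M, hM⟩
    rcases hM.eq_image_prod hf hop with ⟨H, hH, rfl⟩ | ⟨r, rfl⟩
    · exact ⟨.inl ⟨H, hH⟩, rfl⟩
    · exact ⟨.inr r, rfl⟩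
  rw [← Nat.card_congr (Equiv.ofBijective Φ ⟨hinj, hsurj⟩), Nat.card_sum]

end RightGroup

/-- The map on `X` determined by a permutation of the classes and a transversal. -/
def transversalMap {X : Type*} (E : Setoid X)
    (p : Equiv.Perm (Quotient E) × ∀ q : Quotient E, {x : X // Quotient.mk E x = q}) : X → X :=
  fun x => p.2 (p.1 (Quotient.mk E x))

theorem mk_transversalMap {X : Type*} (E : Setoid X)
    (p : Equiv.Perm (Quotient E) × ∀ q : Quotient E, {x : X // Quotient.mk E x = q}) (x : X) :
    Quotient.mk E (transversalMap E p x) = p.1 (Quotient.mk E x) :=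
  (p.2 _).2

theorem transversalMap_injective {X : Type*} (E : Setoid X) :
    Function.Injective (transversalMap E) := by
  rintro ⟨σ, t⟩ ⟨σ', t'⟩ h
  obtain rfl : σ = σ' := by
    ext q
    induction q using Quotient.inductionOn with
    | h x => exact (mk_transversalMap E (σ, t) x).symm.trans (h ▸ mk_transversalMap E (σ', t') x)
  refine Prod.ext rfl (funext fun q => Subtype.ext ?_)
  obtain ⟨q, rfl⟩ := σ.surjective q
  induction q using Quotient.inductionOn with
  | h x => exact congrFun h x

theorem rcomp_transversalMap {X : Type*} (E : Setoid X)
    (a b : Equiv.Perm (Quotient E) × ∀ q : Quotient E, {x : X // Quotient.mk E x = q}) :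
    rcomp (transversalMap E a) (transversalMap E b) = transversalMap E (b.1 * a.1, b.2) := by
  funext x
  change (b.2 (b.1 (Quotient.mk E (transversalMap E a x)))).1 = _
  rw [mk_transversalMap]
  rfl

theorem range_transversalMap {X : Type*} [Finite X] (E : Setoid X) :
    Set.range (transversalMap E) = QEstar E := by
  ext α
  constructor
  · rintro ⟨p, rfl⟩
    refine ⟨fun x y => ?_, fun x y h => ?_, fun x => ?_⟩
    · rw [← Quotient.eq, ← Quotient.eq, mk_transversalMap, mk_transversalMap,
        p.1.injective.eq_iff]
    · exact congrArg (fun q => (p.2 (p.1 q)).1) (Quotient.sound h)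
    · obtain ⟨z, hz⟩ := Quotient.exists_rep (p.1.symm (Quotient.mk E x))
      refine ⟨z, Quotient.exact (s := E) ?_⟩
      rw [mk_transversalMap, hz, Equiv.apply_symm_apply]
  · rintro ⟨h₁, h₂, -⟩
    let β : Quotient E → X := Quotient.lift α h₂
    have hβ : Function.Injective fun q => Quotient.mk E (β q) := by
      intro q q'
      induction q using Quotient.inductionOn
      induction q' using Quotient.inductionOn
      exact fun h => Quotient.sound ((h₁ _ _).2 (Quotient.exact h))
    let σ : Equiv.Perm (Quotient E) := Equiv.ofBijective _ (Finite.injective_iff_bijective.1 hβ)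
    refine ⟨(σ, fun q => ⟨β (σ.symm q), σ.apply_symm_apply q⟩), funext fun x => ?_⟩
    change β (σ.symm (σ (Quotient.mk E x))) = α x
    rw [Equiv.symm_apply_apply]
    rfl

theorem nontrivial_transversal {X : Type*} (E : Setoid X) (hE : ∃ x y : X, x ≠ y ∧ E.r x y) :
    Nontrivial (∀ q : Quotient E, {x : X // Quotient.mk E x = q}) := by
  classical
  obtain ⟨x, y, hxy, h⟩ := hE
  let t : ∀ q : Quotient E, {x : X // Quotient.mk E x = q} := fun q => ⟨q.out, q.out_eq⟩
  refine ⟨Function.update t (Quotient.mk E x) ⟨x, rfl⟩,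
    Function.update t (Quotient.mk E x) ⟨y, (Quotient.sound h).symm⟩, fun h' => hxy ?_⟩
  simpa using congrFun h' (Quotient.mk E x)

/-- let `X` be a finite nonempty set and `E` an equivalence relation on `X`
which is not the identity relation, with `n = |X/E|` classes and `m` the product of the class
sizes. Then the number of maximal proper subsemigroups of `Q_{E^*}(X)` equals `sₙ + m`, where
`sₙ` is the number of maximal subgroups of the symmetric group on `X/E`. -/
theorem stmt19 {X : Type*} [Fintype X] [Nonempty X] (E : Setoid X)
    (hE : ∃ x y : X, x ≠ y ∧ E.r x y)
    [Fintype (Quotient E)]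
    (m : ℕ) (hm : m = ∏ q : Quotient E, Nat.card {x : X // Quotient.mk E x = q}) :
    Nat.card {M : Set (X → X) //
        M ⊆ QEstar E ∧ (∀ a ∈ M, ∀ b ∈ M, rcomp a b ∈ M) ∧ M ≠ QEstar E ∧
        ∀ N : Set (X → X), N ⊆ QEstar E → (∀ a ∈ N, ∀ b ∈ N, rcomp a b ∈ N) →
          M ⊂ N → N = QEstar E}
      = Nat.card {H : Subgroup (Equiv.Perm (Quotient E)) //
          H ≠ ⊤ ∧ ∀ K : Subgroup (Equiv.Perm (Quotient E)), H < K → K = ⊤} + m := by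
  have := nontrivial_transversal E hE
  rw [hm, ← Nat.card_pi, ← range_transversalMap]
  exact card_isMaximalClosedIn_range (transversalMap_injective E) (rcomp_transversalMap E)
end
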